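/- Every Sylow subgroup of a finite nilpotent BCI-group is a BCI-group. -/

import Mathlib

open SimpleGraph

/-- The bi-Cayley graph `BCay(G,S)`: vertex set `G × {1,2}` (encoded as `G × Fin 2`,
where index `0` stands for part `1` and index `1` for part `2`), with edges
`{(g,1),(sg,2)}` for `g ∈ G`, `s ∈ S`. -/
def BCay (G : Type*) [Group G] (S : Set G) : SimpleGraph (G × Fin 2) :=
  SimpleGraph.fromRel (fun u v => u.2 = 0 ∧ v.2 = 1 ∧ v.1 * u.1⁻¹ ∈ S)

/-- `BCay(G,S)` is a BCI-graph. -/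
def IsBCIGraph (G : Type*) [Group G] (S : Set G) : Prop :=
  ∀ T : Set G, Nonempty (BCay G S ≃g BCay G T) →
    ∃ (g : G) (α : G ≃* G), T = (fun s => g * α s) '' S

/-- `G` is a BCI-group. -/
def IsBCIGroup (G : Type*) [Group G] : Prop :=
  ∀ S : Set G, IsBCIGraph G S

/-- `G` is an `m`-BCI-group. -/
def IsmBCIGroup (G : Type*) [Group G] (m : ℕ) : Prop :=
  ∀ S : Set G, S.ncard ≤ m → IsBCIGraph G S

/-- The Cayley graph `Cay(G,S)`, for `1 ∉ S = S⁻¹`. -/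
def Cay (G : Type*) [Group G] (S : Set G) : SimpleGraph G :=
  SimpleGraph.fromRel (fun x y => y * x⁻¹ ∈ S)

/-- `Cay(G,S)` is a CI-graph. -/
def IsCIGraph (G : Type*) [Group G] (S : Set G) : Prop :=
  ∀ T : Set G, 1 ∉ T → T⁻¹ = T → Nonempty (Cay G S ≃g Cay G T) →
    ∃ α : G ≃* G, T = α '' S

/-- `G` is a CI-group. -/
def IsCIGroup (G : Type*) [Group G] : Prop :=
  ∀ S : Set G, 1 ∉ S → S⁻¹ = S → IsCIGraph G S

/-- `G` is an `m`-CI-group. -/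
def IsmCIGroup (G : Type*) [Group G] (m : ℕ) : Prop :=
  ∀ S : Set G, 1 ∉ S → S⁻¹ = S → S.ncard ≤ m → IsCIGraph G S

theorem BCay_adj {G : Type*} [Group G] {S : Set G} {u v : G × Fin 2} :
    (BCay G S).Adj u v ↔
      (u.2 = 0 ∧ v.2 = 1 ∧ v.1 * u.1⁻¹ ∈ S) ∨ (v.2 = 0 ∧ u.2 = 1 ∧ u.1 * v.1⁻¹ ∈ S) := by
  simp only [BCay, SimpleGraph.fromRel_adj, and_iff_right_iff_imp]
  rintro h rfl
  rcases h with h | h <;> exact absurd (h.1.symm.trans h.2.1) (by decide)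

/-- Splitting a vertex of a bi-Cayley graph over `G` along a right transversal `R` of `H`. -/
noncomputable def bCayVertexEquiv {G : Type*} [Group G] {H : Subgroup G} {R : Set G}
    (hR : Subgroup.IsComplement (H : Set G) R) : G × Fin 2 ≃ (H × Fin 2) × R where
  toFun u := (((hR.equiv u.1).1, u.2), (hR.equiv u.1).2)
  invFun w := (hR.equiv.symm (w.1.1, w.2), w.1.2)
  left_inv u := by simp
  right_inv w := by simp

theorem mul_inv_mem_image_iff {G : Type*} [Group G] {H : Subgroup G} {R : Set G}
    (hR : Subgroup.IsComplement (H : Set G) R) (S : Set H) (x y : G) :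
    y * x⁻¹ ∈ ((↑) : H → G) '' S ↔
      (hR.equiv x).2 = (hR.equiv y).2 ∧
        (hR.equiv y).1 * ((hR.equiv x).1 : H)⁻¹ ∈ S := by
  constructor
  · rintro ⟨s, hs, h⟩
    have hy : y = s * x := by rw [h]; group
    have e := hR.equiv_mul_left s x
    rw [← hy] at e
    rw [e]
    refine ⟨rfl, ?_⟩
    have : s * (hR.equiv x).1 * (hR.equiv x).1⁻¹ = s := by group
    exact this.symm ▸ hs
  · rintro ⟨h, hs⟩
    refine ⟨_, hs, ?_⟩
    conv_rhs => rw [← hR.equiv_fst_mul_equiv_snd x, ← hR.equiv_fst_mul_equiv_snd y, h]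
    push_cast
    group

theorem BCay_image_adj_iff {G : Type*} [Group G] {H : Subgroup G} {R : Set G}
    (hR : Subgroup.IsComplement (H : Set G) R) (S : Set H) (u v : G × Fin 2) :
    (BCay G (((↑) : H → G) '' S)).Adj u v ↔
      (bCayVertexEquiv hR u).2 = (bCayVertexEquiv hR v).2 ∧
        (BCay H S).Adj (bCayVertexEquiv hR u).1 (bCayVertexEquiv hR v).1 := by
  simp only [BCay_adj, mul_inv_mem_image_iff hR, bCayVertexEquiv, Equiv.coe_fn_mk]
  rw [eq_comm (a := (hR.equiv v.1).2)]
  tauto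

theorem nonempty_BCay_image_iso {G : Type*} [Group G] (H : Subgroup G) {S T : Set H}
    (φ : BCay H S ≃g BCay H T) :
    Nonempty (BCay G (((↑) : H → G) '' S) ≃g BCay G (((↑) : H → G) '' T)) := by
  obtain ⟨R, hR, -⟩ := H.exists_isComplement_right 1
  refine ⟨⟨(bCayVertexEquiv hR).trans
    ((φ.toEquiv.prodCongr (Equiv.refl R)).trans (bCayVertexEquiv hR).symm), ?_⟩⟩
  intro u v
  simp [BCay_image_adj_iff hR, φ.map_rel_iff]

theorem IsBCIGroup.of_characteristic {G : Type*} [Group G] (hG : IsBCIGroup G)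
    (H : Subgroup G) [hH : H.Characteristic] : IsBCIGroup H := by
  rintro S T ⟨φ⟩
  obtain ⟨g, α, h⟩ := hG _ _ (nonempty_BCay_image_iso H φ)
  have hα : H.map α.toMonoidHom = H := Subgroup.characteristic_iff_map_eq.mp hH α
  let β : H ≃* H := (α.subgroupMap H).trans (MulEquiv.subgroupCongr hα)
  have hβ (s : H) : (β s : G) = α s := rfl
  rcases S.eq_empty_or_nonempty with rfl | ⟨s, hs⟩
  · refine ⟨1, β, ?_⟩
    simpa using h
  · have hg : g ∈ H := by
      obtain ⟨t, -, ht⟩ : g * α s ∈ ((↑) : H → G) '' T := h ▸ ⟨s, ⟨s, hs, rfl⟩, rfl⟩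
      exact (H.mul_mem_cancel_right (β s).2).mp (hβ s ▸ ht ▸ t.2)
    refine ⟨⟨g, hg⟩, β, Subtype.val_injective.image_injective ?_⟩
    rw [h, Set.image_image, Set.image_image]
    rfl

/-- Every Sylow subgroup of a finite nilpotent BCI-group is a BCI-group. -/
theorem sylow_of_nilpotent_BCIGroup (G : Type*) [Group G] [Finite G]
    [Group.IsNilpotent G] (hBCI : IsBCIGroup G)
    (p : ℕ) (hp : p.Prime) (P : Sylow p G) :
    IsBCIGroup (P : Subgroup G) := by
  have : Fact p.Prime := ⟨hp⟩
  have hP : (P : Subgroup G).Normal :=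
    (Group.isNilpotent_of_finite_tfae.out 0 3 rfl rfl).mp ‹_› p ‹_› P
  have := P.characteristic_of_normal hP
  exact hBCI.of_characteristic P
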